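/- Let B ∈ C²_loc(ℝ³,ℝ³) be a nowhere vanishing divergence-free vector field and x₀, v₀ ∈ ℝ³. For each ω > 0 let x_ω denote the unique solution of ẍ_ω(t) = ω (ẋ_ω(t) × B(x_ω(t))) with x_ω(0) = x₀, ẋ_ω(0) = v₀. Then there exists x ∈ C³_loc(ℝ,ℝ³) such that x_ω → x in C^{0,α}_loc(ℝ,ℝ³) for all 0 ≤ α < 1 as ω → ∞ (i.e., for every compact K ⊂ ℝ the α-Hölder norm of x_ω − x on K tends to 0). Moreover ẋ(t) = h(t) b(x(t)) for a suitable function h ∈ C²_loc(ℝ), where b(y) := B(y)/|B(y)|, and the magnetic moment μ(t) := (|v₀|² − h(t)²)/(2|B(x(t))|) is independent of t. -/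

import Mathlib

open MeasureTheory Filter RealInnerProductSpace

noncomputable section

abbrev E3 := EuclideanSpace ℝ (Fin 3)

/-- Cross product on `E3`. -/
def cross (u v : E3) : E3 :=
  !₂[u 1 * v 2 - u 2 * v 1, u 2 * v 0 - u 0 * v 2, u 0 * v 1 - u 1 * v 0]

/-- Partial derivative of `f` in the `i`-th coordinate direction. -/
def pd (f : E3 → E3) (i : Fin 3) (x : E3) : E3 := fderiv ℝ f x (EuclideanSpace.single i 1)

/-- Curl of a vector field. -/
def curl (f : E3 → E3) (x : E3) : E3 :=
  !₂[pd f 1 x 2 - pd f 2 x 1, pd f 2 x 0 - pd f 0 x 2, pd f 0 x 1 - pd f 1 x 0]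

/-- Divergence of a vector field. -/
def divergence (f : E3 → E3) (x : E3) : ℝ := ∑ i, pd f i x i
/-- Convergence in $C^{0,\alpha}_{loc}$ as $\omega\to\infty$: for every compact
$K\subset\mathbb{R}$ the $\alpha$-Hölder norm of $f_\omega - g$ on $K$ tends to $0$
(both the sup part and the Hölder seminorm part become arbitrarily small). -/
def HolderLocConv {E : Type*} [NormedAddCommGroup E] (f : ℝ → ℝ → E) (g : ℝ → E)
    (α : ℝ) : Prop :=
  ∀ K : Set ℝ, IsCompact K → ∀ ε > 0, ∃ W : ℝ, ∀ ω ≥ W,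
    (∀ t ∈ K, ‖f ω t - g t‖ ≤ ε) ∧
    ∀ s ∈ K, ∀ t ∈ K, ‖(f ω s - g s) - (f ω t - g t)‖ ≤ ε * |s - t| ^ α

section Averaging

open Set Topology

theorem dist_le_of_approx_trajectories_two_sided {E : Type*} [NormedAddCommGroup E]
    [NormedSpace ℝ E] {F : E → E} {K : NNReal} {s : Set E} (hF : LipschitzOnWith K F s)
    {f g f' g' : ℝ → E} {T δ ε₁ ε₂ : ℝ}
    (hf : ∀ t, HasDerivAt f (f' t) t) (hg : ∀ t, HasDerivAt g (g' t) t)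
    (hfF : ∀ t, |t| ≤ T → dist (f' t) (F (f t)) ≤ ε₁)
    (hgF : ∀ t, |t| ≤ T → dist (g' t) (F (g t)) ≤ ε₂)
    (hfs : ∀ t, |t| ≤ T → f t ∈ s) (hgs : ∀ t, |t| ≤ T → g t ∈ s)
    (h0 : dist (f 0) (g 0) ≤ δ) {t : ℝ} (ht : |t| ≤ T) :
    dist (f t) (g t) ≤ gronwallBound δ K (ε₁ + ε₂) |t| := by
  rcases le_total 0 t with h | h
  · have key := dist_le_of_approx_trajectories_ODE_of_mem (v := fun _ => F) (s := fun _ => s)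
      (K := K) (f := f) (g := g) (f' := f') (g' := g') (a := 0) (b := t) (εf := ε₁) (εg := ε₂)
      (δ := δ) (fun _ _ => hF) (fun u _ => (hf u).continuousAt.continuousWithinAt)
      (fun u _ => (hf u).hasDerivWithinAt)
      (fun u hu => hfF u ((abs_le_abs_of_nonneg hu.1 hu.2.le).trans ht))
      (fun u hu => hfs u ((abs_le_abs_of_nonneg hu.1 hu.2.le).trans ht))
      (fun u _ => (hg u).continuousAt.continuousWithinAt)
      (fun u _ => (hg u).hasDerivWithinAt)
      (fun u hu => hgF u ((abs_le_abs_of_nonneg hu.1 hu.2.le).trans ht))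
      (fun u hu => hgs u ((abs_le_abs_of_nonneg hu.1 hu.2.le).trans ht)) h0 t ⟨h, le_rfl⟩
    simpa [abs_of_nonneg h] using key
  · have hrev : ∀ {k k' : ℝ → E}, (∀ t, HasDerivAt k (k' t) t) →
        ∀ u, HasDerivAt (fun u => k (-u)) (-k' (-u)) u := by
      intro k k' hk u
      simpa [Function.comp_def] using (hk (-u)).scomp u (hasDerivAt_neg u)
    have hle : ∀ u ∈ Ico 0 (-t), |(-u)| ≤ T := fun u hu => by
      rw [abs_neg, abs_of_nonneg hu.1]
      rw [abs_of_nonpos h] at ht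
      exact hu.2.le.trans ht
    have key := dist_le_of_approx_trajectories_ODE_of_mem (v := fun _ y => -F y)
      (s := fun _ => s)
      (K := K) (f := fun u => f (-u)) (g := fun u => g (-u)) (f' := fun u => -f' (-u))
      (g' := fun u => -g' (-u)) (a := 0) (b := -t) (εf := ε₁) (εg := ε₂)
      (δ := δ) (fun _ _ => hF.neg) (fun u _ => (hrev hf u).continuousAt.continuousWithinAt)
      (fun u _ => (hrev hf u).hasDerivWithinAt)
      (fun u hu => by rw [dist_neg_neg]; exact hfF _ (hle u hu))
      (fun u hu => hfs _ (hle u hu))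
      (fun u _ => (hrev hg u).continuousAt.continuousWithinAt)
      (fun u _ => (hrev hg u).hasDerivWithinAt)
      (fun u hu => by rw [dist_neg_neg]; exact hgF _ (hle u hu))
      (fun u hu => hgs _ (hle u hu)) (by simpa using h0) (-t) ⟨by linarith, le_rfl⟩
    simpa [abs_of_nonpos h] using key

theorem gronwallBound_mul (k δ K ε x : ℝ) :
    gronwallBound (k * δ) K (k * ε) x = k * gronwallBound δ K ε x := by
  unfold gronwallBound
  split_ifs <;> ring

theorem ContDiff.exists_lipschitzOnWith_closedBall {E G : Type*} [NormedAddCommGroup E]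
    [NormedSpace ℝ E] [ProperSpace E] [NormedAddCommGroup G] [NormedSpace ℝ G] {F : E → G}
    (hF : ContDiff ℝ 1 F) (y : E) (r : ℝ) :
    ∃ K : NNReal, LipschitzOnWith K F (Metric.closedBall y r) := by
  obtain ⟨C, hC⟩ := (isCompact_closedBall y r).exists_bound_of_continuousOn
    (hF.continuous_fderiv one_ne_zero).continuousOn
  refine ⟨C.toNNReal, (convex_closedBall y r).lipschitzOnWith_of_nnnorm_fderiv_le
    (fun x _ => hF.differentiable one_ne_zero x) fun x hx => ?_⟩
  rw [← NNReal.coe_le_coe, coe_nnnorm]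
  exact (hC x hx).trans (Real.le_coe_toNNReal C)

/-- Averaging principle for `ṗ = X₀(p) + ω X₁(p)` as `ω → ∞`: if the slow variable `Φ` is
constant along the fast field `X₁`, and `Ψ` solves the homological equation that removes the
oscillating part of its slow drift, then `Φ(p)` converges at rate `1/ω` to a solution of the
averaged equation `Ż = F(Z)`. -/
theorem exists_averaged_limit {P E : Type*} [NormedAddCommGroup P] [NormedSpace ℝ P]
    [NormedAddCommGroup E] [NormedSpace ℝ E] [FiniteDimensional ℝ E]
    {F : E → E} (hF : ContDiff ℝ 1 F) {X₀ X₁ : P → P} (hX₀ : Continuous X₀)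
    {Φ Ψ : P → E} (hΦ : ContDiff ℝ 1 Φ) (hΨ : ContDiff ℝ 1 Ψ)
    {S : ℝ → Set P} (hS : ∀ T, IsCompact (S T))
    (hΦX₁ : ∀ T, ∀ p ∈ S T, fderiv ℝ Φ p (X₁ p) = 0)
    (hΦX₀ : ∀ T, ∀ p ∈ S T, fderiv ℝ Φ p (X₀ p) = F (Φ p) + fderiv ℝ Ψ p (X₁ p))
    {p : ℝ → ℝ → P}
    (hp : ∀ ω > (0 : ℝ), ∀ t, HasDerivAt (p ω) (X₀ (p ω t) + ω • X₁ (p ω t)) t)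
    (hpS : ∀ T, ∀ ω > (0 : ℝ), ∀ t, |t| ≤ T → p ω t ∈ S T)
    {p₀ : P} (hinit : ∀ ω > (0 : ℝ), p ω 0 = p₀) :
    ∃ Z : ℝ → E, (∀ t, HasDerivAt Z (F (Z t)) t) ∧
      ∀ T, ∃ C, ∀ ω ≥ (1 : ℝ), ∀ t, |t| ≤ T → ‖Φ (p ω t) - Z t‖ ≤ C * ω⁻¹ := by
  have : ProperSpace E := FiniteDimensional.proper ℝ E
  have : CompleteSpace E := FiniteDimensional.complete ℝ E
  let Y : ℝ → ℝ → E := fun ω t => Φ (p ω t) - ω⁻¹ • Ψ (p ω t)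
  let Y' : ℝ → ℝ → E := fun ω t =>
    F (Φ (p ω t)) - ω⁻¹ • fderiv ℝ Ψ (p ω t) (X₀ (p ω t))
  have hY : ∀ ω > (0 : ℝ), ∀ t, HasDerivAt (Y ω) (Y' ω t) t := by
    intro ω hω t
    have h1 := (hΦ.differentiable one_ne_zero (p ω t)).hasFDerivAt.comp_hasDerivAt t (hp ω hω t)
    have h2 := (hΨ.differentiable one_ne_zero (p ω t)).hasFDerivAt.comp_hasDerivAt t (hp ω hω t)
    have hmem := hpS |t| ω hω t le_rfl
    refine (h1.sub (h2.const_smul ω⁻¹)).congr_deriv ?_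
    simp only [map_add, map_smul, hΦX₁ _ _ hmem, hΦX₀ _ _ hmem, smul_add, smul_zero, Y',
      smul_smul, inv_mul_cancel₀ hω.ne', one_smul]
    abel
  have hbd : ∀ T, ∃ r M : ℝ, ∃ K : NNReal, 0 ≤ M ∧ LipschitzOnWith K F (Metric.closedBall 0 r) ∧
      ∀ ω ≥ (1 : ℝ), ∀ t, |t| ≤ T → Φ (p ω t) ∈ Metric.closedBall (0 : E) r ∧
        Y ω t ∈ Metric.closedBall (0 : E) r ∧ ‖Ψ (p ω t)‖ ≤ M ∧
        dist (Y' ω t) (F (Y ω t)) ≤ ω⁻¹ * (K * M + M) := by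
    intro T
    obtain ⟨a, ha⟩ := (hS T).exists_bound_of_continuousOn hΦ.continuous.continuousOn
    obtain ⟨m, hm⟩ := (hS T).exists_bound_of_continuousOn hΨ.continuous.continuousOn
    obtain ⟨n, hn⟩ := (hS T).exists_bound_of_continuousOn
      ((hΨ.continuous_fderiv one_ne_zero).clm_apply hX₀).continuousOn
    have hM0 : 0 ≤ max (max m n) 0 := le_max_right _ _
    obtain ⟨K, hK⟩ := hF.exists_lipschitzOnWith_closedBall 0 (a + max (max m n) 0)
    refine ⟨a + max (max m n) 0, max (max m n) 0, K, hM0, hK, fun ω hω t ht => ?_⟩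
    generalize hM : max (max m n) 0 = M at *
    have hω0 : 0 < ω := by linarith
    have hmem := hpS T ω hω0 t ht
    have hΨM : ‖Ψ (p ω t)‖ ≤ M :=
      (hm _ hmem).trans (by rw [← hM]; exact (le_max_left _ _).trans (le_max_left _ _))
    have hDM : ‖fderiv ℝ Ψ (p ω t) (X₀ (p ω t))‖ ≤ M :=
      (hn _ hmem).trans (by rw [← hM]; exact (le_max_right _ _).trans (le_max_left _ _))
    have hωi : ω⁻¹ ≤ 1 := inv_le_one_of_one_le₀ hω
    have hωp : 0 < ω⁻¹ := inv_pos.2 hω0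
    have hsm : ‖ω⁻¹ • Ψ (p ω t)‖ ≤ ω⁻¹ * M := by
      rw [norm_smul, Real.norm_of_nonneg hωp.le]; gcongr
    have hΦr : Φ (p ω t) ∈ Metric.closedBall (0 : E) (a + M) := by
      rw [mem_closedBall_zero_iff]; linarith [ha _ hmem]
    have hYr : Y ω t ∈ Metric.closedBall (0 : E) (a + M) := by
      rw [mem_closedBall_zero_iff]
      have := norm_sub_le (Φ (p ω t)) (ω⁻¹ • Ψ (p ω t))
      have h3 : ω⁻¹ * M ≤ M := mul_le_of_le_one_left hM0 hωi
      exact this.trans (by linarith [ha _ hmem])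
    refine ⟨hΦr, hYr, hΨM, ?_⟩
    have h4 := hK.dist_le_mul _ hΦr _ hYr
    have h5 : dist (Φ (p ω t)) (Y ω t) ≤ ω⁻¹ * M := by
      rw [dist_eq_norm]; simpa [Y] using hsm
    have h6 : dist (Y' ω t) (F (Φ (p ω t))) ≤ ω⁻¹ * M := by
      rw [dist_eq_norm]
      simp only [Y', sub_sub_cancel_left, norm_neg]
      rw [norm_smul, Real.norm_of_nonneg hωp.le]; gcongr
    calc _ ≤ _ := dist_triangle _ (F (Φ (p ω t))) _
      _ ≤ ω⁻¹ * M + K * (ω⁻¹ * M) := by gcongr; exact h4.trans (by gcongr)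
      _ = _ := by ring
  have hcauchy : ∀ T, ∃ C : ℝ, 0 ≤ C ∧ ∀ ω ≥ (1 : ℝ), ∀ ω' ≥ (1 : ℝ), ∀ t, |t| ≤ T →
      dist (Y ω t) (Y ω' t) ≤ (ω⁻¹ + ω'⁻¹) * C := by
    intro T
    obtain ⟨r, M, K, hM, hK, h⟩ := hbd T
    have hmono := gronwallBound_mono (δ := M) (K := K) (ε := K * M + M) hM (by positivity)
      K.coe_nonneg
    by_cases hT : T < 0
    · exact ⟨0, le_rfl, fun ω _ ω' _ t ht => absurd (abs_nonneg t) (by linarith)⟩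
    have hT' := not_lt.1 hT
    refine ⟨gronwallBound M K (K * M + M) T,
      le_trans (by rw [gronwallBound_x0]; exact hM) (hmono hT'), ?_⟩
    intro ω hω ω' hω' t ht
    have hω0 : 0 < ω := by linarith
    have hω0' : 0 < ω' := by linarith
    have hT0 : |(0 : ℝ)| ≤ T := by simpa using hT'
    have h0 : dist (Y ω 0) (Y ω' 0) ≤ (ω⁻¹ + ω'⁻¹) * M := by
      have hΨ0 := (h ω hω 0 hT0).2.2.1
      simp only [Y]
      rw [hinit ω hω0] at hΨ0 ⊢
      rw [hinit ω' hω0', dist_eq_norm, sub_sub_sub_cancel_left, ← sub_smul, norm_smul]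
      gcongr
      refine (norm_sub_le _ _).trans_eq ?_
      rw [Real.norm_of_nonneg (by positivity), Real.norm_of_nonneg (by positivity), add_comm]
    have key := dist_le_of_approx_trajectories_two_sided hK (hY ω hω0) (hY ω' hω0')
      (fun u hu => (h ω hω u hu).2.2.2) (fun u hu => (h ω' hω' u hu).2.2.2)
      (fun u hu => (h ω hω u hu).2.1) (fun u hu => (h ω' hω' u hu).2.1) h0 ht
    rw [← add_mul, gronwallBound_mul] at key
    refine key.trans ?_
    gcongr
    exact hmono ht
  have hinv : Tendsto (fun ω : ℝ => ω⁻¹) atTop (𝓝 0) := tendsto_inv_atTop_zero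
  have hlim : ∀ t, ∃ z, Tendsto (fun ω => Y ω t) atTop (𝓝 z) := by
    intro t
    obtain ⟨C, hC0, hC⟩ := hcauchy |t|
    refine cauchy_map_iff_exists_tendsto.1 (Metric.cauchy_iff.2 ⟨inferInstance, fun ε hε => ?_⟩)
    have h1 : Tendsto (fun ω : ℝ => (ω⁻¹ + ω⁻¹) * C) atTop (𝓝 0) := by
      simpa using (hinv.add hinv).mul_const C
    obtain ⟨N, hN, hN1⟩ := ((h1.eventually (gt_mem_nhds hε)).and (eventually_ge_atTop 1)).exists
    refine ⟨(fun ω => Y ω t) '' Ici N, image_mem_map (Ici_mem_atTop N), ?_⟩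
    rintro _ ⟨ω, hω, rfl⟩ _ ⟨ω', hω', rfl⟩
    rw [mem_Ici] at hω hω'
    refine (hC ω (hN1.trans hω) ω' (hN1.trans hω') t le_rfl).trans_lt (lt_of_le_of_lt ?_ hN)
    gcongr
  choose Z hZ using hlim
  have hYZ : ∀ T, ∃ C : ℝ, 0 ≤ C ∧ ∀ ω ≥ (1 : ℝ), ∀ t, |t| ≤ T →
      dist (Y ω t) (Z t) ≤ C * ω⁻¹ := by
    intro T
    obtain ⟨C, hC0, hC⟩ := hcauchy T
    refine ⟨C, hC0, fun ω hω t ht => ?_⟩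
    have h1 : Tendsto (fun ω' : ℝ => (ω⁻¹ + ω'⁻¹) * C) atTop (𝓝 (C * ω⁻¹)) := by
      have := (hinv.const_add ω⁻¹).mul_const C
      rwa [add_zero, mul_comm] at this
    exact le_of_tendsto_of_tendsto (tendsto_const_nhds.dist (hZ t)) h1
      ((eventually_ge_atTop 1).mono fun ω' hω' => hC ω hω ω' hω' t ht)
  refine ⟨Z, fun t => ?_, fun T => ?_⟩
  · refine hasDerivAt_of_tendstoUniformlyOn (l := atTop) (f := Y) (f' := Y')
      (g' := fun t => F (Z t)) (s := Metric.ball 0 (|t| + 1)) Metric.isOpen_ball ?_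
      ((eventually_gt_atTop 0).mono fun ω hω u _ => hY ω hω u) (fun u _ => hZ u)
      (by simp)
    obtain ⟨r, M, K, hM, hK, h⟩ := hbd (|t| + 1)
    obtain ⟨C, hC0, hC⟩ := hYZ (|t| + 1)
    rw [Metric.tendstoUniformlyOn_iff]
    intro ε hε
    have h1 : Tendsto (fun ω : ℝ => ω⁻¹ * (K * M + M + K * C)) atTop (𝓝 0) := by
      simpa using hinv.mul_const (K * M + M + K * C)
    filter_upwards [h1.eventually (gt_mem_nhds hε), eventually_ge_atTop 1] with ω hω hω1 u hu
    have hu' : |u| ≤ |t| + 1 := by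
      rw [mem_ball_zero_iff, Real.norm_eq_abs] at hu
      exact hu.le
    have hZr : Z u ∈ Metric.closedBall (0 : E) r :=
      Metric.isClosed_closedBall.mem_of_tendsto (hZ u)
        ((eventually_ge_atTop 1).mono fun ω hω => (h ω hω u hu').2.1)
    have hYu := h ω hω1 u hu'
    have h2 := hK.dist_le_mul _ hYu.2.1 _ hZr
    rw [dist_comm]
    calc _ ≤ _ := dist_triangle _ (F (Y ω u)) _
      _ ≤ ω⁻¹ * (K * M + M) + K * (C * ω⁻¹) := by
        gcongr
        · exact hYu.2.2.2
        · exact h2.trans (by gcongr; exact hC ω hω1 u hu')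
      _ = ω⁻¹ * (K * M + M + K * C) := by ring
      _ < ε := hω
  · obtain ⟨r, M, K, hM, hK, h⟩ := hbd T
    obtain ⟨C, hC0, hC⟩ := hYZ T
    refine ⟨M + C, fun ω hω t ht => ?_⟩
    have h1 : dist (Φ (p ω t)) (Y ω t) ≤ M * ω⁻¹ := by
      rw [dist_eq_norm]
      have hω0 : 0 < ω := by linarith
      simp only [Y, sub_sub_cancel]
      rw [norm_smul, Real.norm_of_nonneg (by positivity), mul_comm]
      gcongr
      exact (h ω hω t ht).2.2.1
    rw [← dist_eq_norm, add_mul]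
    exact (dist_triangle _ (Y ω t) _).trans (add_le_add h1 (hC ω hω t ht))

end Averaging

section CrossProduct

/-- The cross product as a continuous bilinear map. -/
def crossCLM : E3 →L[ℝ] E3 →L[ℝ] E3 :=
  LinearMap.toContinuousLinearMap
    ((LinearMap.toContinuousLinearMap : (E3 →ₗ[ℝ] E3) ≃ₗ[ℝ] (E3 →L[ℝ] E3)).toLinearMap ∘ₗ
      LinearMap.mk₂ ℝ cross
        (fun u u' v => by ext i; fin_cases i <;> simp [cross] <;> ring)
        (fun c u v => by ext i; fin_cases i <;> simp [cross] <;> ring)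
        (fun u v v' => by ext i; fin_cases i <;> simp [cross] <;> ring)
        (fun c u v => by ext i; fin_cases i <;> simp [cross] <;> ring))

theorem crossCLM_apply (u v : E3) : crossCLM u v = cross u v := rfl

theorem inner_eq_sum_coord (u v : E3) : ⟪u, v⟫ = u 0 * v 0 + u 1 * v 1 + u 2 * v 2 := by
  simp [PiLp.inner_apply, Fin.sum_univ_three]; ring

theorem sum_sq_coord_eq_one {b : E3} (hb : ‖b‖ = 1) : b 0 * b 0 + b 1 * b 1 + b 2 * b 2 = 1 := by
  rw [← inner_eq_sum_coord, real_inner_self_eq_norm_sq, hb, one_pow]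

theorem cross_smul_right (c : ℝ) (u v : E3) : cross u (c • v) = c • cross u v := by
  simp only [← crossCLM_apply, map_smul]

theorem inner_cross_self_left (u v : E3) : ⟪u, cross u v⟫ = 0 := by
  simp [inner_eq_sum_coord, cross]; ring

theorem inner_cross_self_right (u v : E3) : ⟪cross u v, v⟫ = 0 := by
  simp [inner_eq_sum_coord, cross]; ring

theorem cross_unit_cross {b : E3} (hb : ‖b‖ = 1) (v : E3) :
    cross b (cross v b) = v - ⟪v, b⟫ • b := by
  have h := sum_sq_coord_eq_one hb
  ext i
  fin_cases i <;> simp [inner_eq_sum_coord, cross]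
  · linear_combination v 0 * h
  · linear_combination v 1 * h
  · linear_combination v 2 * h

theorem cross_cross_unit {b : E3} (hb : ‖b‖ = 1) (v : E3) :
    cross (cross v b) b = ⟪v, b⟫ • b - v := by
  have h := sum_sq_coord_eq_one hb
  ext i
  fin_cases i <;> simp [inner_eq_sum_coord, cross]
  · linear_combination -v 0 * h
  · linear_combination -v 1 * h
  · linear_combination -v 2 * h

theorem coord_clm_apply (A : E3 →L[ℝ] E3) (w : E3) (i : Fin 3) :
    A w i = w 0 * A (EuclideanSpace.single 0 1) i + w 1 * A (EuclideanSpace.single 1 1) i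
      + w 2 * A (EuclideanSpace.single 2 1) i := by
  have hw : w = w 0 • EuclideanSpace.single 0 (1 : ℝ) + w 1 • EuclideanSpace.single 1 (1 : ℝ)
      + w 2 • EuclideanSpace.single 2 (1 : ℝ) := by
    ext j; fin_cases j <;> simp
  conv_lhs => rw [hw]
  simp

/-- The quadratic form of a matrix whose range is orthogonal to the unit vector `b`, summed over
the orthogonal frame spanned by the part of `v` normal to `b` and by `v × b`. -/
theorem inner_add_inner_cross_eq_trace {A : E3 →L[ℝ] E3} {b : E3} (hb : ‖b‖ = 1)
    (hA : ∀ w, ⟪b, A w⟫ = 0) (v : E3) :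
    ⟪v, A v⟫ + ⟪cross v b, A (cross v b)⟫ - ⟪v, b⟫ * ⟪v, A b⟫ =
      (‖v‖ ^ 2 - ⟪v, b⟫ ^ 2) * ∑ i, A (EuclideanSpace.single i 1) i := by
  have h := sum_sq_coord_eq_one hb
  have h0 := hA (EuclideanSpace.single 0 1)
  have h1 := hA (EuclideanSpace.single 1 1)
  have h2 := hA (EuclideanSpace.single 2 1)
  rw [inner_eq_sum_coord] at h0 h1 h2
  rw [← real_inner_self_eq_norm_sq, Fin.sum_univ_three]
  simp only [inner_eq_sum_coord, coord_clm_apply A v, coord_clm_apply A b,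
    coord_clm_apply A (cross v b)]
  generalize A (EuclideanSpace.single 0 1) = p at *
  generalize A (EuclideanSpace.single 1 1) = q at *
  generalize A (EuclideanSpace.single 2 1) = r at *
  simp only [cross, PiLp.toLp_apply, Matrix.cons_val_zero, Matrix.cons_val_one, Matrix.cons_val]
  generalize v 0 = v₀, v 1 = v₁, v 2 = v₂, b 0 = b₀, b 1 = b₁, b 2 = b₂ at *
  linear_combination
    ((v₀ * b₀ + v₁ * b₁ + v₂ * b₂) * v₀ - (v₀ * v₀ + v₁ * v₁ + v₂ * v₂) * b₀) * h0 +
    ((v₀ * b₀ + v₁ * b₁ + v₂ * b₂) * v₁ - (v₀ * v₀ + v₁ * v₁ + v₂ * v₂) * b₁) * h1 +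
    ((v₀ * b₀ + v₁ * b₁ + v₂ * b₂) * v₂ - (v₀ * v₀ + v₁ * v₁ + v₂ * v₂) * b₂) * h2 +
    ((v₀ * v₀ + v₁ * v₁ + v₂ * v₂) * (p 0 + q 1 + r 2)
      - (v₀ * (v₀ * p 0 + v₁ * q 0 + v₂ * r 0) + v₁ * (v₀ * p 1 + v₁ * q 1 + v₂ * r 1)
        + v₂ * (v₀ * p 2 + v₁ * q 2 + v₂ * r 2))) * h

end CrossProduct

section GuidingCentre

open Set Topology

theorem ContDiff.divergence {f : E3 → E3} (hf : ContDiff ℝ 2 f) : ContDiff ℝ 1 (divergence f) := by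
  refine ContDiff.sum fun i _ => ?_
  have h1 : ContDiff ℝ 1 (fun x => fderiv ℝ f x (EuclideanSpace.single i 1)) :=
    (hf.fderiv_right (by norm_num)).clm_apply contDiff_const
  exact contDiff_euclidean.1 h1 i

/-- Slow variables: the position and the velocity parallel to the field direction `b`. -/
def slowVar (b : E3 → E3) (p : E3 × E3) : E3 × ℝ := (p.1, ⟪p.2, b p.1⟫)

/-- The guiding centre vector field with energy parameter `c = |v₀|`. -/
def guidingField (b : E3 → E3) (c : ℝ) (z : E3 × ℝ) : E3 × ℝ :=
  (z.2 • b z.1, (c ^ 2 - z.2 ^ 2) / 2 * divergence b z.1)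

/-- The generator removing the gyration from the slow variables, where `N = |B|`. -/
def gyroCorrector (b : E3 → E3) (N : E3 → ℝ) (p : E3 × E3) : E3 × ℝ :=
  ((N p.1)⁻¹ • crossCLM (b p.1) p.2,
    -(N p.1)⁻¹ * (⟪p.2, fderiv ℝ b p.1 (crossCLM p.2 (b p.1))⟫ / 2
      + ⟪p.2, b p.1⟫ * ⟪crossCLM p.2 (b p.1), fderiv ℝ b p.1 (b p.1)⟫))

variable {b : E3 → E3} {N : E3 → ℝ}

theorem contDiff_slowVar (hb : ContDiff ℝ 2 b) : ContDiff ℝ 1 (slowVar b) := by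
  have hb1 : ContDiff ℝ 1 b := hb.of_le (by norm_num)
  exact contDiff_fst.prodMk (contDiff_snd.inner ℝ (hb1.comp contDiff_fst))

theorem contDiff_guidingField (hb : ContDiff ℝ 2 b) (c : ℝ) :
    ContDiff ℝ 1 (guidingField b c) := by
  have hb1 : ContDiff ℝ 1 b := hb.of_le (by norm_num)
  have hd := hb.divergence
  unfold guidingField
  fun_prop

theorem contDiff_gyroCorrector (hb : ContDiff ℝ 2 b) (hN : ContDiff ℝ 2 N) (hN0 : ∀ y, N y ≠ 0) :
    ContDiff ℝ 1 (gyroCorrector b N) := by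
  have hb1 : ContDiff ℝ 1 fun p : E3 × E3 => b p.1 :=
    (hb.of_le (by norm_num)).comp contDiff_fst
  have hNi : ContDiff ℝ 1 fun p : E3 × E3 => (N p.1)⁻¹ :=
    ((hN.of_le (by norm_num)).comp contDiff_fst).inv fun p => hN0 p.1
  have hA : ContDiff ℝ 1 fun p : E3 × E3 => fderiv ℝ b p.1 :=
    (hb.fderiv_right (by norm_num)).comp contDiff_fst
  have hu : ContDiff ℝ 1 fun p : E3 × E3 => crossCLM p.2 (b p.1) :=
    (crossCLM.contDiff.comp contDiff_snd).clm_apply hb1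
  have hu' : ContDiff ℝ 1 fun p : E3 × E3 => crossCLM (b p.1) p.2 :=
    (crossCLM.contDiff.comp hb1).clm_apply contDiff_snd
  refine (hNi.smul hu').prodMk (hNi.neg.mul (ContDiff.add ?_ ?_))
  · exact (contDiff_snd.inner ℝ (hA.clm_apply hu)).div_const 2
  · exact (contDiff_snd.inner ℝ hb1).mul (hu.inner ℝ (hA.clm_apply hb1))

theorem inner_fderiv_eq_zero_of_norm_eq_one (hb : ContDiff ℝ 2 b) (hb1 : ∀ y, ‖b y‖ = 1)
    (y w : E3) : ⟪b y, fderiv ℝ b y w⟫ = 0 := by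
  have hd := (hb.differentiable (by norm_num) y).hasFDerivAt
  have h1 : HasFDerivAt (fun x => ⟪b x, b x⟫) _ y := hd.inner ℝ hd
  have h2 : (fun x => ⟪b x, b x⟫) = fun _ => (1 : ℝ) := by
    ext x; rw [real_inner_self_eq_norm_sq, hb1, one_pow]
  rw [h2] at h1
  have h3 := DFunLike.congr_fun (h1.unique (hasFDerivAt_const (1 : ℝ) y)) w
  simp [fderivInnerCLM_apply, real_inner_comm] at h3
  simpa [real_inner_comm] using h3

theorem fderiv_slowVar (hb : ContDiff ℝ 2 b) (x v ξ η : E3) :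
    fderiv ℝ (slowVar b) (x, v) (ξ, η) = (ξ, ⟪v, fderiv ℝ b x ξ⟫ + ⟪η, b x⟫) := by
  have hd : HasFDerivAt b (fderiv ℝ b x) (x, v).1 :=
    (hb.differentiable (by norm_num) x).hasFDerivAt
  have h := (hasFDerivAt_fst (𝕜 := ℝ) (p := (x, v))).prodMk
    ((hasFDerivAt_snd (𝕜 := ℝ) (p := (x, v))).inner ℝ (hd.comp (x, v) hasFDerivAt_fst))
  have h' : HasFDerivAt (slowVar b) _ (x, v) := h
  rw [h'.fderiv]
  simp [fderivInnerCLM_apply]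

theorem fderiv_gyroCorrector_vertical (hb : ContDiff ℝ 2 b) (hN : ContDiff ℝ 2 N)
    (hN0 : ∀ y, N y ≠ 0) (x v w : E3) :
    fderiv ℝ (gyroCorrector b N) (x, v) (0, w) =
      ((N x)⁻¹ • cross (b x) w,
        -(N x)⁻¹ * ((⟪v, fderiv ℝ b x (cross w (b x))⟫ + ⟪w, fderiv ℝ b x (cross v (b x))⟫) / 2
          + (⟪w, b x⟫ * ⟪cross v (b x), fderiv ℝ b x (b x)⟫
            + ⟪v, b x⟫ * ⟪cross w (b x), fderiv ℝ b x (b x)⟫))) := by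
  have h1 := ((contDiff_gyroCorrector hb hN hN0).differentiable one_ne_zero (x, v)).hasFDerivAt
  have hl : HasDerivAt (fun s : ℝ => (x, v + s • w)) ((0 : E3), w) 0 := by
    have := ((hasDerivAt_id (0 : ℝ)).smul_const w).const_add v
    simpa using (hasDerivAt_const (0 : ℝ) x).prodMk this
  have h2 : HasDerivAt (fun s : ℝ => gyroCorrector b N (x, v + s • w))
      (fderiv ℝ (gyroCorrector b N) (x, v) (0, w)) 0 :=
    HasFDerivAt.comp_hasDerivAt (l := gyroCorrector b N) (f := fun s : ℝ => (x, v + s • w)) 0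
      (by simpa using h1) hl
  have hv : HasDerivAt (fun s : ℝ => v + s • w) w 0 := by
    simpa using ((hasDerivAt_id (0 : ℝ)).smul_const w).const_add v
  have hu : HasDerivAt (fun s : ℝ => crossCLM (v + s • w) (b x)) (crossCLM w (b x)) 0 :=
    (crossCLM.flip (b x)).hasFDerivAt.comp_hasDerivAt 0 hv
  have hu' : HasDerivAt (fun s : ℝ => crossCLM (b x) (v + s • w)) (crossCLM (b x) w) 0 :=
    (crossCLM (b x)).hasFDerivAt.comp_hasDerivAt 0 hv
  have hAu := (fderiv ℝ b x).hasFDerivAt.comp_hasDerivAt (0 : ℝ) hu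
  have h3 : HasDerivAt (fun s : ℝ => gyroCorrector b N (x, v + s • w)) _ 0 :=
    (hu'.const_smul (N x)⁻¹).prodMk
      ((((hv.inner ℝ hAu).div_const 2).add
        ((hv.inner ℝ (hasDerivAt_const (0 : ℝ) (b x))).mul
          (hu.inner ℝ (hasDerivAt_const (0 : ℝ) (fderiv ℝ b x (b x)))))).const_mul (-(N x)⁻¹))
  rw [h2.unique h3]
  simp [crossCLM_apply]

/-- The homological equation for the gyration generated by the field `N b`. -/
theorem fderiv_slowVar_eq_guidingField_add (hb : ContDiff ℝ 2 b) (hb1 : ∀ y, ‖b y‖ = 1)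
    (hN : ContDiff ℝ 2 N) (hN0 : ∀ y, N y ≠ 0) (x v : E3) :
    fderiv ℝ (slowVar b) (x, v) (v, 0) = guidingField b ‖v‖ (slowVar b (x, v)) +
      fderiv ℝ (gyroCorrector b N) (x, v) (0, cross v (N x • b x)) := by
  have hA := inner_fderiv_eq_zero_of_norm_eq_one hb hb1 x
  have htr := inner_add_inner_cross_eq_trace (hb1 x) hA v
  rw [fderiv_slowVar hb, fderiv_gyroCorrector_vertical hb hN hN0, cross_smul_right,
    cross_smul_right, cross_unit_cross (hb1 x)]
  have hs : cross (N x • cross v (b x)) (b x) = N x • (⟪v, b x⟫ • b x - v) := by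
    rw [← cross_cross_unit (hb1 x), ← crossCLM_apply, map_smul]; rfl
  rw [hs]
  have hNx := hN0 x
  ext1
  · simp [guidingField, slowVar, smul_smul, hNx]
  · simp only [guidingField, slowVar, Prod.snd_add, map_smul, map_sub, inner_smul_left,
      inner_smul_right, inner_sub_left, inner_sub_right, hA, inner_cross_self_right,
      inner_zero_left]
    simp only [divergence, pd, RCLike.conj_to_real]
    field_simp
    linear_combination htr

/-- For a divergence-free field `N b`, the divergence of its direction is `-∂_b N / N`. -/
theorem fderiv_apply_add_mul_divergence_eq_zero (hb : ContDiff ℝ 2 b) (hN : ContDiff ℝ 2 N)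
    {B : E3 → E3} (hB : ∀ y, B y = N y • b y) (hdiv : ∀ y, divergence B y = 0) (y : E3) :
    fderiv ℝ N y (b y) + N y * divergence b y = 0 := by
  have hbd := (hb.differentiable (by norm_num) y).hasFDerivAt
  have hNd := (hN.differentiable (by norm_num) y).hasFDerivAt
  have hBd : HasFDerivAt B _ y := (hNd.smul hbd).congr_of_eventuallyEq (.of_forall hB)
  have h := hdiv y
  have hby : b y = ∑ i, b y i • EuclideanSpace.single i (1 : ℝ) := by
    ext j; fin_cases j <;> simp [Fin.sum_univ_three]
  have hNb : fderiv ℝ N y (b y) = ∑ i, b y i * fderiv ℝ N y (EuclideanSpace.single i 1) := by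
    conv_lhs => rw [hby]
    simp
  rw [← h, hNb]
  simp only [divergence, pd, hBd.fderiv, Finset.mul_sum, ← Finset.sum_add_distrib]
  refine Finset.sum_congr rfl fun i _ => ?_
  simp
  ring

/-- Conservation of the magnetic moment along the guiding centre flow. -/
theorem magneticMoment_eq (hb : ContDiff ℝ 2 b) (hN : ContDiff ℝ 2 N) (hN0 : ∀ y, N y ≠ 0)
    {B : E3 → E3} (hB : ∀ y, B y = N y • b y) (hdiv : ∀ y, divergence B y = 0)
    {c : ℝ} {Z : ℝ → E3 × ℝ} (hZ : ∀ t, HasDerivAt Z (guidingField b c (Z t)) t) (s t : ℝ) :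
    (c ^ 2 - (Z s).2 ^ 2) / (2 * N (Z s).1) = (c ^ 2 - (Z t).2 ^ 2) / (2 * N (Z t).1) := by
  have hd : ∀ t, HasDerivAt (fun t => (c ^ 2 - (Z t).2 ^ 2) / (2 * N (Z t).1)) 0 t := by
    intro t
    have hx : HasDerivAt (fun t => (Z t).1) ((Z t).2 • b (Z t).1) t :=
      (ContinuousLinearMap.fst ℝ E3 ℝ).hasFDerivAt.comp_hasDerivAt t (hZ t)
    have hh : HasDerivAt (fun t => (Z t).2)
        ((c ^ 2 - (Z t).2 ^ 2) / 2 * divergence b (Z t).1) t :=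
      (ContinuousLinearMap.snd ℝ E3 ℝ).hasFDerivAt.comp_hasDerivAt t (hZ t)
    have hNx : HasDerivAt (fun t => N (Z t).1) (fderiv ℝ N (Z t).1 ((Z t).2 • b (Z t).1)) t :=
      (hN.differentiable (by norm_num) _).hasFDerivAt.comp_hasDerivAt t hx
    have hN' := hN0 (Z t).1
    have hz := fderiv_apply_add_mul_divergence_eq_zero hb hN hB hdiv (Z t).1
    refine (((hh.fun_pow 2).const_sub (c ^ 2)).div (hNx.const_mul 2)
      (mul_ne_zero two_ne_zero hN')).congr_deriv ?_
    rw [map_smul, smul_eq_mul, div_eq_zero_iff]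
    left
    push_cast
    linear_combination -2 * (Z t).2 * (c ^ 2 - (Z t).2 ^ 2) * hz
  exact is_const_of_deriv_eq_zero (fun t => (hd t).differentiableAt) (fun t => (hd t).deriv) s t

theorem contDiff_guidingCentre (hb : ContDiff ℝ 2 b) {c : ℝ} {Z : ℝ → E3 × ℝ}
    (hZ : ∀ t, HasDerivAt Z (guidingField b c (Z t)) t) :
    ContDiff ℝ 3 (fun t => (Z t).1) ∧ ContDiff ℝ 2 (fun t => (Z t).2) := by
  have hF := contDiff_guidingField hb c
  have hZd : Differentiable ℝ Z := fun t => (hZ t).differentiableAt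
  have hderiv : deriv Z = fun t => guidingField b c (Z t) := funext fun t => (hZ t).deriv
  have hZ1 : ContDiff ℝ 1 Z := by
    rw [contDiff_one_iff_deriv, hderiv]
    exact ⟨hZd, hF.continuous.comp hZd.continuous⟩
  have hZ2 : ContDiff ℝ (1 + 1) Z := by
    rw [contDiff_succ_iff_deriv, hderiv]
    exact ⟨hZd, by simp, hF.comp hZ1⟩
  rw [one_add_one_eq_two] at hZ2
  refine ⟨?_, hZ2.snd⟩
  have hx : ∀ t, HasDerivAt (fun t => (Z t).1) ((Z t).2 • b (Z t).1) t := fun t =>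
    (ContinuousLinearMap.fst ℝ E3 ℝ).hasFDerivAt.comp_hasDerivAt t (hZ t)
  have h3 : ContDiff ℝ (2 + 1) (fun t => (Z t).1) := by
    rw [contDiff_succ_iff_deriv, show deriv (fun t => (Z t).1) = fun t => (Z t).2 • b (Z t).1 from
      funext fun t => (hx t).deriv]
    exact ⟨fun t => (hx t).differentiableAt, by simp, hZ2.snd.smul (hb.comp hZ2.fst)⟩
  rwa [show (2 + 1 : WithTop ℕ∞) = 3 by norm_num] at h3

/-- Uniformly Lipschitz functions which converge locally uniformly with rate `1/ω` converge in
every local Hölder space of exponent less than one. -/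
theorem HolderLocConv.of_lipschitz_of_rate {E : Type*} [NormedAddCommGroup E]
    {f : ℝ → ℝ → E} {g : ℝ → E} {c : ℝ}
    (hf : ∀ ω > (0 : ℝ), ∀ s t, ‖f ω s - f ω t‖ ≤ c * |s - t|)
    (hfg : ∀ T, ∃ C, ∀ ω ≥ (1 : ℝ), ∀ t, |t| ≤ T → ‖f ω t - g t‖ ≤ C * ω⁻¹)
    {α : ℝ} (hα0 : 0 ≤ α) (hα1 : α < 1) : HolderLocConv f g α := by
  have hc : 0 ≤ c := by simpa using (norm_nonneg _).trans (hf 1 one_pos 1 0)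
  have hlim : ∀ t, Tendsto (fun ω => f ω t) atTop (𝓝 (g t)) := by
    intro t
    obtain ⟨C, hC⟩ := hfg |t|
    rw [tendsto_iff_norm_sub_tendsto_zero]
    refine squeeze_zero' (.of_forall fun _ => norm_nonneg _)
      ((eventually_ge_atTop 1).mono fun ω hω => hC ω hω t le_rfl) ?_
    simpa using tendsto_inv_atTop_zero.const_mul C
  have hg : ∀ s t, ‖g s - g t‖ ≤ c * |s - t| := fun s t =>
    le_of_tendsto ((hlim s).sub (hlim t)).norm
      ((eventually_gt_atTop 0).mono fun ω hω => hf ω hω s t)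
  intro K hK ε hε
  obtain ⟨T, hT⟩ := hK.isBounded.exists_norm_le
  obtain ⟨C, hC⟩ := hfg T
  have h1 : Tendsto (fun ω : ℝ => C * ω⁻¹) atTop (𝓝 0) := by
    simpa using tendsto_inv_atTop_zero.const_mul C
  have h2 : Tendsto (fun ω : ℝ => (2 * (|C| * ω⁻¹)) ^ (1 - α) * (2 * c) ^ α) atTop (𝓝 0) := by
    have h3 : Tendsto (fun ω : ℝ => 2 * (|C| * ω⁻¹)) atTop (𝓝 0) := by
      simpa using (tendsto_inv_atTop_zero.const_mul |C|).const_mul 2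
    have h4 := (h3.rpow_const (p := 1 - α) (Or.inr (by linarith))).mul_const ((2 * c) ^ α)
    rwa [Real.zero_rpow (by linarith), zero_mul] at h4
  obtain ⟨W, hW⟩ := eventually_atTop.1 ((h1.eventually (ge_mem_nhds hε)).and
    ((h2.eventually (ge_mem_nhds hε)).and (eventually_ge_atTop 1)))
  refine ⟨W, fun ω hω => ?_⟩
  obtain ⟨hω1, hω2, hω3⟩ := hW ω hω
  have hω0 : 0 < ω := by linarith
  refine ⟨fun t ht => (hC ω hω3 t (hT t ht)).trans hω1, fun s hs t ht => ?_⟩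
  set d := ‖(f ω s - g s) - (f ω t - g t)‖ with hd
  have hd0 : 0 ≤ d := norm_nonneg _
  have hdC : d ≤ 2 * (|C| * ω⁻¹) := by
    have hle : C * ω⁻¹ ≤ |C| * ω⁻¹ := by gcongr; exact le_abs_self C
    linarith [norm_sub_le (f ω s - g s) (f ω t - g t), hC ω hω3 s (hT s hs), hC ω hω3 t (hT t ht)]
  have hdL : d ≤ 2 * c * |s - t| := by
    have := norm_sub_le (f ω s - f ω t) (g s - g t)
    rw [hd, sub_sub_sub_comm]
    linarith [hf ω hω0 s t, hg s t]
  calc d = d ^ (1 - α) * d ^ α := by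
        rw [← Real.rpow_add_of_nonneg hd0 (by linarith) hα0, sub_add_cancel, Real.rpow_one]
    _ ≤ (2 * (|C| * ω⁻¹)) ^ (1 - α) * (2 * c * |s - t|) ^ α := by
        gcongr
    _ = (2 * (|C| * ω⁻¹)) ^ (1 - α) * (2 * c) ^ α * |s - t| ^ α := by
        rw [Real.mul_rpow (by positivity) (abs_nonneg _), mul_assoc]
    _ ≤ ε * |s - t| ^ α := by gcongr

/-- The speed is conserved along solutions of the Lorentz equation. -/
theorem norm_velocity_eq {B : E3 → E3} {ω : ℝ} {y v : ℝ → E3}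
    (hv : ∀ t, HasDerivAt v (ω • cross (v t) (B (y t))) t) (t : ℝ) : ‖v t‖ = ‖v 0‖ := by
  have hd : ∀ t, HasDerivAt (fun t => ‖v t‖ ^ 2) 0 t := fun t =>
    (hv t).norm_sq.congr_deriv (by
      rw [inner_smul_right, inner_cross_self_left, mul_zero, mul_zero])
  have := is_const_of_deriv_eq_zero (fun t => (hd t).differentiableAt) (fun t => (hd t).deriv) t 0
  exact (sq_eq_sq₀ (norm_nonneg _) (norm_nonneg _)).1 this

end GuidingCentre

/-- Zero order guiding centre theorem (Theorem 1.1): existence of the limit trajectory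
$x$, the parallel speed $h$ with $\dot x = h\,b(x)$, and conservation of the magnetic
moment $\mu(t) = (|v_0|^2 - h(t)^2)/(2|B(x(t))|)$. -/
theorem stmt5 (B : E3 → E3) (hB : ContDiff ℝ 2 B) (hne : ∀ y : E3, B y ≠ 0)
    (hdiv : ∀ y : E3, divergence B y = 0) (x₀ v₀ : E3)
    (b : E3 → E3) (hb : b = fun y => ‖B y‖⁻¹ • B y)
    (xω : ℝ → ℝ → E3)
    (hxC : ∀ ω > (0:ℝ), ContDiff ℝ 2 (xω ω))
    (hode : ∀ ω > (0:ℝ), ∀ t : ℝ,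
      deriv (deriv (xω ω)) t = ω • cross (deriv (xω ω) t) (B (xω ω t)))
    (hinit : ∀ ω > (0:ℝ), xω ω 0 = x₀ ∧ deriv (xω ω) 0 = v₀) :
    ∃ x : ℝ → E3, ∃ h : ℝ → ℝ, ContDiff ℝ 3 x ∧ ContDiff ℝ 2 h ∧
      (∀ α : ℝ, 0 ≤ α → α < 1 → HolderLocConv xω x α) ∧
      (∀ t : ℝ, deriv x t = h t • b (x t)) ∧
      (∀ t : ℝ, (‖v₀‖ ^ 2 - h t ^ 2) / (2 * ‖B (x t)‖) =
        (‖v₀‖ ^ 2 - h 0 ^ 2) / (2 * ‖B (x 0)‖)) := by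
  have hN : ContDiff ℝ 2 fun y => ‖B y‖ := hB.norm ℝ hne
  have hN0 : ∀ y, ‖B y‖ ≠ 0 := fun y => norm_ne_zero_iff.2 (hne y)
  have hbC : ContDiff ℝ 2 b := by
    rw [hb]
    exact (hN.inv hN0).smul hB
  have hb1 : ∀ y, ‖b y‖ = 1 := fun y => by
    rw [hb]
    simp [norm_smul, hN0 y]
  have hBb : ∀ y, B y = ‖B y‖ • b y := fun y => by
    rw [hb]
    simp [smul_smul, hN0 y]
  have hx : ∀ ω > (0 : ℝ), ∀ t, HasDerivAt (xω ω) (deriv (xω ω) t) t := fun ω hω t =>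
    ((hxC ω hω).differentiable (by norm_num) t).hasDerivAt
  have hv : ∀ ω > (0 : ℝ), ∀ t,
      HasDerivAt (deriv (xω ω)) (ω • cross (deriv (xω ω) t) (B (xω ω t))) t := by
    intro ω hω t
    rw [← hode ω hω t]
    have hC : ContDiff ℝ (1 + 1) (xω ω) := by
      rw [one_add_one_eq_two]
      exact hxC ω hω
    exact ((contDiff_succ_iff_deriv.1 hC).2.2.differentiable one_ne_zero t).hasDerivAt
  have hspeed : ∀ ω > (0 : ℝ), ∀ t, ‖deriv (xω ω) t‖ = ‖v₀‖ := fun ω hω t => by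
    rw [norm_velocity_eq (hv ω hω) t, (hinit ω hω).2]
  have hlip : ∀ ω > (0 : ℝ), ∀ s t, ‖xω ω s - xω ω t‖ ≤ ‖v₀‖ * |s - t| := fun ω hω s t =>
    convex_univ.norm_image_sub_le_of_norm_deriv_le (fun u _ => (hx ω hω u).differentiableAt)
      (fun u _ => (hspeed ω hω u).le) (Set.mem_univ t) (Set.mem_univ s)
  obtain ⟨Z, hZ, hconv⟩ := exists_averaged_limit (contDiff_guidingField hbC ‖v₀‖)
    (X₀ := fun p : E3 × E3 => (p.2, 0)) (X₁ := fun p : E3 × E3 => (0, cross p.2 (B p.1)))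
    (by fun_prop) (contDiff_slowVar hbC) (contDiff_gyroCorrector hbC hN hN0)
    (S := fun T => Metric.closedBall x₀ (‖v₀‖ * T) ×ˢ Metric.sphere 0 ‖v₀‖)
    (fun T => (isCompact_closedBall _ _).prod (isCompact_sphere _ _))
    (fun T p _ => by
      rw [fderiv_slowVar hbC, hBb, cross_smul_right, inner_smul_left, inner_cross_self_right]
      simp)
    (fun T p hp => by
      have hp2 : ‖p.2‖ = ‖v₀‖ := by simpa using hp.2
      rw [fderiv_slowVar_eq_guidingField_add hbC hb1 hN hN0, hp2, ← hBb])
    (p := fun ω t => (xω ω t, deriv (xω ω) t))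
    (fun ω hω t => ((hx ω hω t).prodMk (hv ω hω t)).congr_deriv (by simp))
    (fun T ω hω t ht => by
      refine ⟨?_, by simpa using hspeed ω hω t⟩
      have h := hlip ω hω t 0
      rw [(hinit ω hω).1, sub_zero] at h
      rw [Metric.mem_closedBall, dist_eq_norm]
      exact h.trans (by gcongr))
    (p₀ := (x₀, v₀)) (fun ω hω => Prod.ext (hinit ω hω).1 (hinit ω hω).2)
  obtain ⟨hx3, hh2⟩ := contDiff_guidingCentre hbC hZ
  refine ⟨fun t => (Z t).1, fun t => (Z t).2, hx3, hh2, fun α hα0 hα1 => ?_, fun t => ?_,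
    fun t => magneticMoment_eq hbC hN hN0 hBb hdiv hZ t 0⟩
  · refine HolderLocConv.of_lipschitz_of_rate hlip (fun T => ?_) hα0 hα1
    obtain ⟨C, hC⟩ := hconv T
    exact ⟨C, fun ω hω t ht => (norm_fst_le _).trans (hC ω hω t ht)⟩
  · have h : HasDerivAt (fun t => (Z t).1) ((Z t).2 • b (Z t).1) t :=
      (ContinuousLinearMap.fst ℝ E3 ℝ).hasFDerivAt.comp_hasDerivAt t (hZ t)
    exact h.deriv
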